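/- arXiv:2012.07375 — 2 statements merged into one kernel-verified Lean document; each statement's English description precedes it below -/
import Mathlib

section
/- For every integer k ≥ 1, the broom B_{2k+1} = B_{(k+1)(2k+1),2k+1} satisfies lb_W(B_{2k+1}) − lb(B_{2k+1}) = 4k³ − 2k² − k + 1 = k[(2k−1)² + 2(k−1)] + 1, which is strictly positive; that is, the weight-center-based lower bound for the hamiltonian chromatic number is strictly larger than the center-based lower bound. -/
open SimpleGraph Finset

namespace HCPaper

variable {V : Type*}

/-- The detour distance `D(u,v)`: the length of a longest `u`–`v` path. -/
noncomputable def detourDist (G : SimpleGraph V) (u v : V) : ℕ :=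
  sSup {n | ∃ p : G.Walk u v, p.IsPath ∧ p.length = n}

/-- A hamiltonian coloring: `D(u,v) + |h u - h v| ≥ n - 1` for all distinct `u, v`. -/
def IsHamiltonianColoring [Fintype V] (G : SimpleGraph V) (h : V → ℕ) : Prop :=
  ∀ u v : V, u ≠ v →
    Fintype.card V - 1 ≤ detourDist G u v + Nat.dist (h u) (h v)

/-- The span of a coloring: the maximum of `|h u - h v|`. -/
noncomputable def spanOf (h : V → ℕ) : ℕ :=
  sSup (Set.range fun p : V × V => Nat.dist (h p.1) (h p.2))

/-- The hamiltonian chromatic number: minimum span over hamiltonian colorings. -/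
noncomputable def hc [Fintype V] (G : SimpleGraph V) : ℕ :=
  sInf {s | ∃ h : V → ℕ, IsHamiltonianColoring G h ∧ spanOf h = s}

/-- The weight of the graph from a vertex `v`. -/
noncomputable def treeWeight [Fintype V] (G : SimpleGraph V) (v : V) : ℕ :=
  ∑ u, G.dist u v

/-- The set of weight centers. -/
def WeightCenters [Fintype V] (G : SimpleGraph V) : Set V :=
  {v | ∀ u, treeWeight G v ≤ treeWeight G u}

/-- The detour level `L(u) = min {d(u,w) : w ∈ W(T)}`. -/
noncomputable def detourLevel [Fintype V] (G : SimpleGraph V) (u : V) : ℕ :=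
  sInf {k | ∃ w ∈ WeightCenters G, G.dist u w = k}

/-- The total detour level `L_W(T) = ∑ L(u)`. -/
noncomputable def totalDetourLevel [Fintype V] (G : SimpleGraph V) : ℕ :=
  ∑ u, detourLevel G u

/-- `ζ(T)` : 0 if one weight center, 1 if two. -/
noncomputable def zeta [Fintype V] (G : SimpleGraph V) : ℕ :=
  if (WeightCenters G).ncard = 2 then 1 else 0

/-- `ζ'(T) = 1 - ζ(T)`. -/
noncomputable def zeta' [Fintype V] (G : SimpleGraph V) : ℕ := 1 - zeta G

/-- `t` is an ancestor of `v` : `t` lies on the path joining the nearest weight center and `v`. -/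
def IsAncestor [Fintype V] (G : SimpleGraph V) (t v : V) : Prop :=
  ∃ w ∈ WeightCenters G, G.dist v w = detourLevel G v ∧
    ∃ p : G.Walk w v, p.IsPath ∧ t ∈ p.support

/-- `φ(u,v)`: maximum detour level of a common ancestor of `u` and `v`. -/
noncomputable def phi [Fintype V] (G : SimpleGraph V) (u v : V) : ℕ :=
  sSup {k | ∃ t, IsAncestor G t u ∧ IsAncestor G t v ∧ detourLevel G t = k}

open Classical in
/-- `δ(u,v)`: 1 if there are two weight centers `w, w'` and the `u`–`v` path contains
the edge `ww'`, 0 otherwise. -/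
noncomputable def delta [Fintype V] (G : SimpleGraph V) (u v : V) : ℕ :=
  if ∃ w w', w ≠ w' ∧ WeightCenters G = {w, w'} ∧
      ∃ p : G.Walk u v, p.IsPath ∧ s(w, w') ∈ p.edges
  then 1 else 0

/-- `u` and `v` lie in different branches: branches at two distinct vertices adjacent to
the same weight center. -/
def InDifferentBranches [Fintype V] (G : SimpleGraph V) (u v : V) : Prop :=
  ∃ w b₁ b₂, w ∈ WeightCenters G ∧ b₁ ≠ b₂ ∧
    b₁ ∉ WeightCenters G ∧ b₂ ∉ WeightCenters G ∧
    G.Adj w b₁ ∧ G.Adj w b₂ ∧ IsAncestor G b₁ u ∧ IsAncestor G b₂ v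

/-- `u` and `v` lie in opposite branches: branches at vertices adjacent to different
weight centers. -/
def InOppositeBranches [Fintype V] (G : SimpleGraph V) (u v : V) : Prop :=
  ∃ w₁ w₂ b₁ b₂, w₁ ∈ WeightCenters G ∧ w₂ ∈ WeightCenters G ∧ w₁ ≠ w₂ ∧
    b₁ ∉ WeightCenters G ∧ b₂ ∉ WeightCenters G ∧
    G.Adj w₁ b₁ ∧ G.Adj w₂ b₂ ∧ IsAncestor G b₁ u ∧ IsAncestor G b₂ v

/-- The eccentricity of a vertex. -/
noncomputable def ecc (G : SimpleGraph V) (v : V) : ℕ :=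
  sSup (Set.range fun u => G.dist v u)

/-- The center of a graph: vertices of minimum eccentricity. -/
def graphCenter (G : SimpleGraph V) : Set V :=
  {v | ∀ u, ecc G v ≤ ecc G u}

/-- The total level with respect to the center `C(T)`. -/
noncomputable def totalLevel [Fintype V] (G : SimpleGraph V) : ℕ :=
  ∑ u, sInf {k | ∃ x ∈ graphCenter G, G.dist u x = k}

/-- `ε(T)` : 0 if the center has one vertex, 1 if two. -/
noncomputable def eps [Fintype V] (G : SimpleGraph V) : ℕ :=
  if (graphCenter G).ncard = 2 then 1 else 0

/-- `ε'(T) = 1 - ε(T)`. -/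
noncomputable def eps' [Fintype V] (G : SimpleGraph V) : ℕ := 1 - eps G

/-- The weight-center based lower bound `lb_W(T)`. -/
noncomputable def lbW [Fintype V] (G : SimpleGraph V) : ℤ :=
  ((Fintype.card V : ℤ) - 1) * ((Fintype.card V : ℤ) - 1 - zeta G) +
    zeta' G - 2 * totalDetourLevel G

/-- The center based lower bound `lb(T)`. -/
noncomputable def lbC [Fintype V] (G : SimpleGraph V) : ℤ :=
  ((Fintype.card V : ℤ) - 1) * ((Fintype.card V : ℤ) - 1 - eps G) +
    eps' G - 2 * totalLevel G

/-- The broom `B_{n,d}`: a path on vertices `0, …, d-1` together with `n - d` pendant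
vertices all adjacent to the end vertex `d-1` of the path. -/
def broom (n d : ℕ) : SimpleGraph (Fin n) :=
  SimpleGraph.fromRel (fun i j =>
    (i.val + 1 = j.val ∧ j.val < d) ∨ (i.val + 1 = d ∧ d ≤ j.val))

/-- The star `K_{1,n-1}`: vertex `0` adjacent to the `n - 1` other vertices. -/
def starGraph (n : ℕ) : SimpleGraph (Fin n) :=
  SimpleGraph.fromRel (fun i _ => i.val = 0)

/-- The caterpillar `C(m,d)`: a spine `v_1, …, v_m` with `d - 2` legs attached to each
inner spine vertex `v_2, …, v_{m-1}` (so each inner spine vertex has degree `d`). -/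
def caterpillar (m d : ℕ) : SimpleGraph (Fin m ⊕ Fin (m - 2) × Fin (d - 2)) :=
  SimpleGraph.fromRel (fun x y =>
    (∃ i j : Fin m, x = Sum.inl i ∧ y = Sum.inl j ∧ i.val + 1 = j.val) ∨
    (∃ i : Fin m, ∃ a : Fin (m - 2), ∃ b : Fin (d - 2),
      x = Sum.inl i ∧ y = Sum.inr (a, b) ∧ i.val = a.val + 1))

lemma broom_exists_walk {n d : ℕ} (m : ℕ) : ∀ a b : Fin n, a.val < d → a.val + m = min b.val d →
    ∃ p : (broom n d).Walk a b, p.length = m := by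
  induction m with
  | zero =>
    intro a b ha h
    obtain rfl : a = b := Fin.ext (by omega)
    exact ⟨Walk.nil, rfl⟩
  | succ m ih =>
    intro a b ha h
    rcases Nat.eq_zero_or_pos m with rfl | hm
    · have hadj : (broom n d).Adj a b := by
        rw [broom, fromRel_adj]
        refine ⟨fun hab => ?_, Or.inl ?_⟩
        · subst hab; omega
        · omega
      exact ⟨hadj.toWalk, rfl⟩
    · let c : Fin n := ⟨a.val + 1, by omega⟩
      have hc : c.val = a.val + 1 := rfl
      have hadj : (broom n d).Adj a c := by
        rw [broom, fromRel_adj]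
        refine ⟨fun hac => ?_, Or.inl (Or.inl ⟨rfl, by omega⟩)⟩
        have := congrArg Fin.val hac
        omega
      obtain ⟨p, hp⟩ := ih c b (by omega) (by omega)
      exact ⟨Walk.cons hadj p, by simp [hp]⟩

lemma broom_connected {n d : ℕ} (hn : 0 < n) (hd : 0 < d) : (broom n d).Connected := by
  rw [connected_iff_exists_forall_reachable]
  refine ⟨⟨0, hn⟩, fun b => ?_⟩
  obtain ⟨p, -⟩ := broom_exists_walk (min b.val d) ⟨0, hn⟩ b hd (by simp)
  exact p.reachable

lemma broom_level_le_walk_length {n d : ℕ} {a b : Fin n} (p : (broom n d).Walk a b) :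
    min a.val d ≤ min b.val d + p.length ∧ min b.val d ≤ min a.val d + p.length := by
  induction p with
  | nil => simp
  | cons h p ih =>
    rw [broom, fromRel_adj] at h
    rw [Walk.length_cons]
    omega

lemma broom_level_le_dist {n d : ℕ} (hd : 0 < d) (a b : Fin n) :
    min a.val d ≤ min b.val d + (broom n d).dist a b ∧
      min b.val d ≤ min a.val d + (broom n d).dist a b := by
  obtain ⟨p, hp⟩ := (broom_connected a.pos hd).exists_walk_length_eq_dist a b
  exact hp ▸ broom_level_le_walk_length p

/-- The distance to a vertex of the path is the difference of the levels `min · d`. -/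
lemma broom_dist {n d : ℕ} (hd : 0 < d) (a b : Fin n) (hb : b.val < d) :
    (broom n d).dist a b = (min a.val d - b.val) + (b.val - a.val) := by
  have hl := broom_level_le_dist hd a b
  rcases le_total b.val a.val with h | h
  · obtain ⟨p, hp⟩ := broom_exists_walk (d := d) (min a.val d - b.val) b a hb (by omega)
    have := dist_le p
    rw [dist_comm] at this
    omega
  · obtain ⟨p, hp⟩ := broom_exists_walk (d := d) (b.val - a.val) a b (by omega) (by omega)
    have := dist_le p
    omega

lemma broom_two_le_dist {n d : ℕ} (hd : 0 < d) {a b : Fin n} (ha : d ≤ a.val) (hb : d ≤ b.val)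
    (hab : a ≠ b) : 2 ≤ (broom n d).dist a b := by
  have h0 := (broom_connected a.pos hd).pos_dist_of_ne hab
  have h1 : (broom n d).dist a b ≠ 1 := by
    rw [Ne, dist_eq_one_iff_adj, broom, fromRel_adj]
    omega
  omega

lemma sInf_dist_pair {G : SimpleGraph V} (u a b : V) :
    sInf {m | ∃ x ∈ ({a, b} : Set V), G.dist u x = m} = min (G.dist u a) (G.dist u b) := by
  have : {m | ∃ x ∈ ({a, b} : Set V), G.dist u x = m} = {G.dist u a, G.dist u b} := by
    ext m; simp [eq_comm]
  rw [this, csInf_pair]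

lemma dist_le_ecc [Finite V] (G : SimpleGraph V) (v u : V) : G.dist v u ≤ ecc G v :=
  le_csSup (Set.finite_range _).bddAbove ⟨u, rfl⟩

lemma ecc_le [Nonempty V] {G : SimpleGraph V} {v : V} {m : ℕ} (h : ∀ u, G.dist v u ≤ m) :
    ecc G v ≤ m :=
  csSup_le (Set.range_nonempty _) (by rintro _ ⟨u, rfl⟩; exact h u)

lemma graphCenter_broom {n k : ℕ} (hk : 1 ≤ k) (hn : 2 * k + 1 < n) :
    graphCenter (broom n (2 * k + 1)) = {⟨k, by omega⟩, ⟨k + 1, by omega⟩} := by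
  set G := broom n (2 * k + 1) with hG
  have : Nonempty (Fin n) := ⟨⟨0, by omega⟩⟩
  have hd : 0 < 2 * k + 1 := by omega
  have hupper : ∀ v : Fin n, v.val = k ∨ v.val = k + 1 → ecc G v ≤ k + 1 := by
    intro v hv
    refine ecc_le fun u => ?_
    rw [dist_comm, hG, broom_dist hd u v (by omega)]
    omega
  have hlower : ∀ v : Fin n, k + 1 ≤ ecc G v ∧
      (v.val ≠ k → v.val ≠ k + 1 → k + 2 ≤ ecc G v) := by
    intro v
    have h0 := dist_le_ecc G v ⟨0, by omega⟩
    have h1 := dist_le_ecc G v ⟨2 * k + 1, hn⟩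
    have h2 := broom_level_le_dist hd v ⟨0, by omega⟩
    have h3 := broom_level_le_dist hd v ⟨2 * k + 1, hn⟩
    rw [← hG] at h2 h3
    simp only [] at h2 h3
    omega
  ext v
  simp only [graphCenter, Set.mem_ofPred_eq, Set.mem_insert_iff, Set.mem_singleton_iff, Fin.ext_iff]
  constructor
  · intro h
    have h1 := h ⟨k, by omega⟩
    have h2 := hupper ⟨k, by omega⟩ (Or.inl rfl)
    have h3 := (hlower v).2
    omega
  · intro hv u
    exact (hupper v hv).trans (hlower u).1

lemma treeWeight_broom_lt {k l : ℕ} (hl : 2 * k < l + 1) (hl2 : 2 ≤ l)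
    (v c : Fin (2 * k + 1 + l)) (hc : c.val = 2 * k) (hv : v ≠ c) :
    treeWeight (broom (2 * k + 1 + l) (2 * k + 1)) c <
      treeWeight (broom (2 * k + 1 + l) (2 * k + 1)) v := by
  set G := broom (2 * k + 1 + l) (2 * k + 1) with hG
  have hd : 0 < 2 * k + 1 := by omega
  have hv' : v.val ≠ 2 * k := fun h => hv (Fin.ext (h.trans hc.symm))
  unfold treeWeight
  have hdc : ∀ u, G.dist u c = (min u.val (2 * k + 1) - 2 * k) + (2 * k - u.val) := by
    intro u
    rw [hG, broom_dist hd u c (by omega), hc]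
  by_cases hlt : v.val < 2 * k
  · obtain ⟨g, hg⟩ : ∃ g, v.val + g = 2 * k := ⟨2 * k - v.val, by omega⟩
    have key : ∑ u : Fin (2 * k + 1 + l),
          (G.dist u c + if u.val < 2 * k then 0 else 2 * g) ≤
        ∑ u : Fin (2 * k + 1 + l), (G.dist u v + g) := by
      refine Finset.sum_le_sum fun u _ => ?_
      rw [hdc, hG, broom_dist hd u v (by omega)]
      split_ifs <;> omega
    have hsum : ∑ u : Fin (2 * k + 1 + l), (if u.val < 2 * k then 0 else 2 * g) =
        (l + 1) * (2 * g) := by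
      rw [Fin.sum_univ_eq_sum_range (fun i => if i < 2 * k then 0 else 2 * g) (2 * k + 1 + l),
        add_assoc, Finset.sum_range_add, Finset.sum_eq_zero]
      · simp [add_comm]
      · intro i hi
        simp_all
    rw [Finset.sum_add_distrib, Finset.sum_add_distrib, hsum, Finset.sum_const, Finset.card_univ,
      Fintype.card_fin, smul_eq_mul] at key
    have hgpos : 0 < g := by omega
    nlinarith [Nat.mul_le_mul_right g hl]
  · have key : ∑ u : Fin (2 * k + 1 + l), (G.dist u c + 1) ≤
        ∑ u : Fin (2 * k + 1 + l), (G.dist u v + if u = v then 2 else 0) := by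
      refine Finset.sum_le_sum fun u _ => ?_
      have h1 := broom_level_le_dist hd u v
      rw [← hG] at h1
      rw [hdc]
      split_ifs with huv
      · omega
      · by_cases hu : u.val < 2 * k + 1
        · omega
        · have h2 := broom_two_le_dist hd (not_lt.mp hu) (by omega : 2 * k + 1 ≤ v.val) huv
          rw [← hG] at h2
          omega
    rw [Finset.sum_add_distrib, Finset.sum_add_distrib, Finset.sum_const, Finset.card_univ,
      Fintype.card_fin, smul_eq_mul, Finset.sum_ite_eq' Finset.univ v] at key
    simp only [Finset.mem_univ, if_true] at key
    omega

lemma weightCenters_broom {k l : ℕ} (hl : 2 * k < l + 1) (hl2 : 2 ≤ l) :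
    WeightCenters (broom (2 * k + 1 + l) (2 * k + 1)) = {⟨2 * k, by omega⟩} := by
  ext v
  rw [Set.mem_singleton_iff]
  constructor
  · intro h
    by_contra hv
    exact (h _).not_gt (treeWeight_broom_lt hl hl2 v ⟨2 * k, by omega⟩ rfl hv)
  · rintro rfl u
    by_cases hu : u = ⟨2 * k, by omega⟩
    · rw [hu]
    · exact (treeWeight_broom_lt hl hl2 u ⟨2 * k, by omega⟩ rfl hu).le

lemma sum_range_tsub_mul_two (m : ℕ) :
    (∑ i ∈ Finset.range (m + 1), (m - i)) * 2 = m * (m + 1) := by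
  have h := Finset.sum_range_reflect (fun i => i) (m + 1)
  simp only [Nat.add_sub_cancel] at h
  rw [h, Finset.sum_range_id_mul_two, Nat.add_sub_cancel, mul_comm]

lemma totalDetourLevel_broom {k l : ℕ} (hl : 2 * k < l + 1) (hl2 : 2 ≤ l) :
    totalDetourLevel (broom (2 * k + 1 + l) (2 * k + 1)) = k * (2 * k + 1) + l := by
  have h : ∀ u : Fin (2 * k + 1 + l), detourLevel (broom (2 * k + 1 + l) (2 * k + 1)) u =
      (min u.val (2 * k + 1) - 2 * k) + (2 * k - u.val) := by
    intro u
    rw [detourLevel, weightCenters_broom hl hl2, ← Set.pair_eq_singleton, sInf_dist_pair,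
      min_self, broom_dist (by omega) _ _ (by simp)]
  rw [totalDetourLevel, Finset.sum_congr rfl fun u _ => h u,
    Fin.sum_univ_eq_sum_range (fun i => (min i (2 * k + 1) - 2 * k) + (2 * k - i)),
    Finset.sum_range_add]
  have h1 : ∑ i ∈ Finset.range (2 * k + 1), ((min i (2 * k + 1) - 2 * k) + (2 * k - i)) =
      ∑ i ∈ Finset.range (2 * k + 1), (2 * k - i) := by
    refine Finset.sum_congr rfl fun i hi => ?_
    rw [Finset.mem_range] at hi
    omega
  have h2 : ∑ i ∈ Finset.range l, ((min (2 * k + 1 + i) (2 * k + 1) - 2 * k) +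
      (2 * k - (2 * k + 1 + i))) = ∑ i ∈ Finset.range l, 1 :=
    Finset.sum_congr rfl fun i _ => by omega
  have h3 := sum_range_tsub_mul_two (2 * k)
  rw [h1, h2, Finset.sum_const, Finset.card_range, smul_eq_mul]
  nlinarith

lemma totalLevel_broom {k l : ℕ} (hk : 1 ≤ k) (hl : 1 ≤ l) :
    totalLevel (broom (2 * k + 1 + l) (2 * k + 1)) = k ^ 2 + l * k := by
  have h : ∀ u : Fin (2 * k + 1 + l), sInf {m | ∃ x ∈ graphCenter
      (broom (2 * k + 1 + l) (2 * k + 1)), (broom (2 * k + 1 + l) (2 * k + 1)).dist u x = m} =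
      (k - u.val) + (min u.val (2 * k + 1) - (k + 1)) := by
    intro u
    rw [graphCenter_broom hk (by omega), sInf_dist_pair, broom_dist (by omega) _ _ (by simp; omega),
      broom_dist (by omega) _ _ (by simp; omega)]
    simp only []
    omega
  rw [totalLevel, Finset.sum_congr rfl fun u _ => h u,
    Fin.sum_univ_eq_sum_range (fun i => (k - i) + (min i (2 * k + 1) - (k + 1))),
    Finset.sum_range_add, show 2 * k + 1 = (k + 1) + k by omega, Finset.sum_range_add]
  have h1 : ∑ i ∈ Finset.range (k + 1), ((k - i) + (min i (k + 1 + k) - (k + 1))) =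
      ∑ i ∈ Finset.range (k + 1), (k - i) := by
    refine Finset.sum_congr rfl fun i hi => ?_
    rw [Finset.mem_range] at hi
    omega
  have h2 : ∑ i ∈ Finset.range k, ((k - (k + 1 + i)) + (min (k + 1 + i) (k + 1 + k) - (k + 1))) =
      ∑ i ∈ Finset.range k, i := by
    refine Finset.sum_congr rfl fun i hi => ?_
    rw [Finset.mem_range] at hi
    omega
  have h3 : ∑ i ∈ Finset.range l, ((k - (k + 1 + k + i)) +
      (min (k + 1 + k + i) (k + 1 + k) - (k + 1))) = ∑ i ∈ Finset.range l, k :=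
    Finset.sum_congr rfl fun i _ => by omega
  have h4 := sum_range_tsub_mul_two k
  have h5 := Finset.sum_range_id_mul_two k
  obtain ⟨j, rfl⟩ := Nat.exists_eq_add_of_le' hk
  rw [Nat.add_sub_cancel] at h5
  rw [h1, h2, h3, Finset.sum_const, Finset.card_range, smul_eq_mul]
  nlinarith

lemma lbW_broom_sub_lbC_broom {k l : ℕ} (hk : 1 ≤ k) (hl : 2 * k < l + 1) (hl2 : 2 ≤ l) :
    lbW (broom (2 * k + 1 + l) (2 * k + 1)) - lbC (broom (2 * k + 1 + l) (2 * k + 1)) =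
      2 * (k : ℤ) * l - l - 2 * (k : ℤ) ^ 2 + 1 := by
  have hz : zeta (broom (2 * k + 1 + l) (2 * k + 1)) = 0 := by
    rw [zeta, weightCenters_broom hl hl2, Set.ncard_singleton, if_neg (by norm_num)]
  have he : eps (broom (2 * k + 1 + l) (2 * k + 1)) = 1 := by
    rw [eps, graphCenter_broom hk (by omega), Set.ncard_pair (by simp [Fin.ext_iff]), if_pos rfl]
  rw [lbW, lbC, zeta', eps', hz, he, totalDetourLevel_broom hl hl2,
    totalLevel_broom hk (by omega), Fintype.card_fin]
  push_cast
  ring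

/-- For `k ≥ 1`, `lb_W(B_{2k+1}) - lb(B_{2k+1}) = 4k³ - 2k² - k + 1
= k[(2k-1)² + 2(k-1)] + 1 > 0`. -/
theorem stmt15 (k : ℕ) (hk : 1 ≤ k) :
    lbW (broom ((k + 1) * (2 * k + 1)) (2 * k + 1)) -
        lbC (broom ((k + 1) * (2 * k + 1)) (2 * k + 1)) =
      4 * (k : ℤ) ^ 3 - 2 * (k : ℤ) ^ 2 - (k : ℤ) + 1 ∧
    4 * (k : ℤ) ^ 3 - 2 * (k : ℤ) ^ 2 - (k : ℤ) + 1 =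
      (k : ℤ) * ((2 * (k : ℤ) - 1) ^ 2 + 2 * ((k : ℤ) - 1)) + 1 ∧
    0 < lbW (broom ((k + 1) * (2 * k + 1)) (2 * k + 1)) -
        lbC (broom ((k + 1) * (2 * k + 1)) (2 * k + 1)) := by
  have hdiff : lbW (broom ((k + 1) * (2 * k + 1)) (2 * k + 1)) -
      lbC (broom ((k + 1) * (2 * k + 1)) (2 * k + 1)) =
      4 * (k : ℤ) ^ 3 - 2 * (k : ℤ) ^ 2 - (k : ℤ) + 1 := by
    rw [show (k + 1) * (2 * k + 1) = 2 * k + 1 + k * (2 * k + 1) by ring,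
      lbW_broom_sub_lbC_broom hk (by nlinarith) (by nlinarith)]
    push_cast
    ring
  have heq : 4 * (k : ℤ) ^ 3 - 2 * (k : ℤ) ^ 2 - (k : ℤ) + 1 =
      (k : ℤ) * ((2 * (k : ℤ) - 1) ^ 2 + 2 * ((k : ℤ) - 1)) + 1 := by ring
  refine ⟨hdiff, heq, ?_⟩
  rw [hdiff, heq]
  have hk' : (0 : ℤ) ≤ (k : ℤ) - 1 := by omega
  positivity

end HCPaper
end

section
/- Let d ≥ 3 and let m = 2k+1 ≥ 3 be odd. Then the hamiltonian chromatic number of the caterpillar C(m,d) is hc(C(m,d)) = ((2d−3)/(2d−2))(n−2)² + (d−1)/2, where n = (2k−1)(d−1) + 2 is the order of C(m,d); equivalently, hc(C(m,d)) = ((d−1)/2)·((2d−3)(2k−1)² + 1). -/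
open SimpleGraph Finset

namespace HCPaper

variable {V : Type*}

section Detour

/-- The lengths of the `u`–`v` paths of a finite graph are bounded. -/
lemma bddAbove_path_lengths [Fintype V] (G : SimpleGraph V) (u v : V) :
    BddAbove {n | ∃ p : G.Walk u v, p.IsPath ∧ p.length = n} := by
  refine ⟨Fintype.card V, ?_⟩
  rintro n ⟨p, hp, rfl⟩
  exact hp.length_lt.le

lemma dist_le_detourDist [Fintype V] {G : SimpleGraph V} (hG : G.Connected) (u v : V) :
    G.dist u v ≤ detourDist G u v := by
  classical
  obtain ⟨p⟩ := hG u v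
  exact (G.dist_le p.bypass).trans
    (le_csSup (bddAbove_path_lengths G u v) ⟨p.bypass, p.bypass_isPath, rfl⟩)

lemma detourDist_le_dist_of_isTree {G : SimpleGraph V} (hG : G.IsTree) (u v : V) :
    detourDist G u v ≤ G.dist u v := by
  classical
  obtain ⟨q, hq⟩ := hG.connected.exists_walk_length_eq_dist u v
  refine csSup_le ⟨_, q.bypass, q.bypass_isPath, rfl⟩ ?_
  rintro n ⟨p, hp, rfl⟩
  have h := (hG.isAcyclic.subsingleton_path u v).elim ⟨p, hp⟩ ⟨q.bypass, q.bypass_isPath⟩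
  rw [← hq, congrArg (fun r : G.Path u v => r.1.length) h]
  exact q.length_bypass_le_length

/-- A function increasing by at most one along each edge bounds the distance from below. -/
lemma le_add_dist_of_lipschitz {G : SimpleGraph V} (hG : G.Connected) (f : V → ℕ)
    (hf : ∀ x y, G.Adj x y → f y ≤ f x + 1) (u v : V) : f v ≤ f u + G.dist u v := by
  obtain ⟨p, hp⟩ := hG.exists_walk_length_eq_dist u v
  rw [← hp]
  clear hp
  induction p with
  | nil => simp
  | cons h p ih =>
    have := hf _ _ h
    rw [Walk.length_cons]
    omega

/-- A connected graph in which every edge joins a vertex other than `r` to its parent is a tree. -/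
lemma isTree_of_parent [Finite V] {G : SimpleGraph V} (hG : G.Connected) (r : V) (f : V → V)
    (hf : ∀ x y, G.Adj x y → (x ≠ r ∧ f x = y) ∨ (y ≠ r ∧ f y = x)) : G.IsTree := by
  classical
  have := Fintype.ofFinite V
  refine isTree_iff_connected_and_card.2 ⟨hG, le_antisymm ?_ hG.card_vert_le_card_edgeSet_add_one⟩
  have hsub : G.edgeSet ⊆ (fun x => s(x, f x)) '' ({r}ᶜ : Set V) := by
    intro e
    induction e with
    | _ x y =>
      intro h
      rcases hf x y h with ⟨hx, rfl⟩ | ⟨hy, rfl⟩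
      · exact ⟨x, hx, rfl⟩
      · exact ⟨y, hy, Sym2.eq_swap⟩
  have h₁ := Set.ncard_le_ncard hsub (Set.toFinite _)
  have h₂ := Set.ncard_image_le (f := fun x => s(x, f x)) (Set.toFinite ({r}ᶜ : Set V))
  have h₃ := Set.ncard_add_ncard_compl ({r} : Set V)
  rw [Set.ncard_singleton] at h₃
  rw [Nat.card_coe_set_eq]
  omega

end Detour

section Caterpillar

variable {m d : ℕ}

/-- The position on the spine of (the foot of) a vertex. -/
def spinePos : Fin m ⊕ Fin (m - 2) × Fin (d - 2) → ℕ :=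
  Sum.elim (fun i => i.val) fun p => p.1.val + 1

/-- The distance of a vertex from the spine. -/
def legHeight : Fin m ⊕ Fin (m - 2) × Fin (d - 2) → ℕ :=
  Sum.elim (fun _ => 0) fun _ => 1

/-- The distance of a vertex from the spine vertex at position `c`. -/
def levelAt (c : ℕ) (x : Fin m ⊕ Fin (m - 2) × Fin (d - 2)) : ℕ :=
  Nat.dist (spinePos x) c + legHeight x

lemma caterpillar_adj_iff (x y : Fin m ⊕ Fin (m - 2) × Fin (d - 2)) :
    (caterpillar m d).Adj x y ↔ x ≠ y ∧
      (((∃ i j : Fin m, x = Sum.inl i ∧ y = Sum.inl j ∧ i.val + 1 = j.val) ∨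
        ∃ i : Fin m, ∃ a : Fin (m - 2), ∃ b : Fin (d - 2),
          x = Sum.inl i ∧ y = Sum.inr (a, b) ∧ i.val = a.val + 1) ∨
      ((∃ i j : Fin m, y = Sum.inl i ∧ x = Sum.inl j ∧ i.val + 1 = j.val) ∨
        ∃ i : Fin m, ∃ a : Fin (m - 2), ∃ b : Fin (d - 2),
          y = Sum.inl i ∧ x = Sum.inr (a, b) ∧ i.val = a.val + 1)) :=
  SimpleGraph.fromRel_adj _ _ _

lemma exists_spine_walk (i n : ℕ) (h : i + n < m) :
    ∃ p : (caterpillar m d).Walk (Sum.inl ⟨i, by omega⟩) (Sum.inl ⟨i + n, h⟩),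
      p.length = n := by
  induction n with
  | zero => exact ⟨Walk.nil, rfl⟩
  | succ n ih =>
    obtain ⟨p, hp⟩ := ih (by omega)
    have hadj : (caterpillar m d).Adj (Sum.inl ⟨i + n, by omega⟩) (Sum.inl ⟨i + (n + 1), h⟩) := by
      rw [caterpillar_adj_iff]
      refine ⟨by simp, Or.inl (Or.inl ⟨_, _, rfl, rfl, rfl⟩)⟩
    exact ⟨p.concat hadj, by rw [Walk.length_concat, hp]⟩

lemma exists_walk_to_spine (c : Fin m) (x : Fin m ⊕ Fin (m - 2) × Fin (d - 2)) :
    ∃ p : (caterpillar m d).Walk x (Sum.inl c), p.length = levelAt c.val x := by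
  have key : ∀ i : Fin m, ∃ p : (caterpillar m d).Walk (Sum.inl i) (Sum.inl c),
      p.length = Nat.dist i.val c.val := by
    intro i
    obtain ⟨i, hi⟩ := i
    obtain ⟨c, hc⟩ := c
    rcases le_total i c with h | h
    · obtain ⟨n, rfl⟩ := Nat.exists_eq_add_of_le h
      obtain ⟨p, hp⟩ := exists_spine_walk (d := d) i n hc
      exact ⟨p, by simp only [Nat.dist]; omega⟩
    · obtain ⟨n, rfl⟩ := Nat.exists_eq_add_of_le h
      obtain ⟨p, hp⟩ := exists_spine_walk (d := d) c n hi
      exact ⟨p.reverse, by rw [Walk.length_reverse]; simp only [Nat.dist]; omega⟩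
  rcases x with i | ⟨a, b⟩
  · simpa [levelAt, spinePos, legHeight] using key i
  · obtain ⟨p, hp⟩ := key ⟨a.val + 1, by omega⟩
    have hadj : (caterpillar m d).Adj (Sum.inr (a, b)) (Sum.inl ⟨a.val + 1, by omega⟩) := by
      rw [caterpillar_adj_iff]
      exact ⟨by simp, Or.inr (Or.inr ⟨_, _, _, rfl, rfl, rfl⟩)⟩
    exact ⟨Walk.cons hadj p, by rw [Walk.length_cons, hp]; rfl⟩

lemma caterpillar_connected (hm : 0 < m) : (caterpillar m d).Connected := by
  have : Nonempty (Fin m ⊕ Fin (m - 2) × Fin (d - 2)) := ⟨Sum.inl ⟨0, hm⟩⟩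
  refine ⟨fun x y => ?_⟩
  obtain ⟨p, -⟩ := exists_walk_to_spine ⟨0, hm⟩ x
  obtain ⟨q, -⟩ := exists_walk_to_spine ⟨0, hm⟩ y
  exact ⟨p.append q.reverse⟩

lemma caterpillar_isTree (hm : 0 < m) : (caterpillar m d).IsTree := by
  refine isTree_of_parent (caterpillar_connected hm) (Sum.inl ⟨0, hm⟩)
    (Sum.elim (fun i => Sum.inl ⟨i.val - 1, by omega⟩)
      fun p => Sum.inl ⟨p.1.val + 1, by omega⟩) ?_
  intro x y h
  rw [caterpillar_adj_iff] at h
  rcases h with ⟨-, (⟨i, j, rfl, rfl, h⟩ | ⟨i, a, b, rfl, rfl, h⟩) |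
    (⟨i, j, rfl, rfl, h⟩ | ⟨i, a, b, rfl, rfl, h⟩)⟩ <;> simp [Fin.ext_iff] <;> omega

lemma detourDist_caterpillar_le (c : Fin m) (u v : Fin m ⊕ Fin (m - 2) × Fin (d - 2)) :
    detourDist (caterpillar m d) u v ≤ levelAt c.val u + levelAt c.val v := by
  obtain ⟨p, hp⟩ := exists_walk_to_spine c u
  obtain ⟨q, hq⟩ := exists_walk_to_spine c v
  refine (detourDist_le_dist_of_isTree (caterpillar_isTree c.pos) u v).trans ?_
  refine ((caterpillar m d).dist_le (p.append q.reverse)).trans ?_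
  rw [Walk.length_append, Walk.length_reverse, hp, hq]

lemma le_detourDist_caterpillar (hm : 0 < m) {u v : Fin m ⊕ Fin (m - 2) × Fin (d - 2)}
    (huv : u ≠ v) :
    Nat.dist (spinePos u) (spinePos v) + legHeight u + legHeight v ≤
      detourDist (caterpillar m d) u v := by
  have h := le_add_dist_of_lipschitz (caterpillar_connected (d := d) hm)
    (fun x => if u = x then 0 else Nat.dist (spinePos u) (spinePos x) + legHeight u + legHeight x)
    (by
      intro x y hxy
      rw [caterpillar_adj_iff] at hxy
      rcases hxy with ⟨-, (⟨i, j, rfl, rfl, h⟩ | ⟨i, a, b, rfl, rfl, h⟩) |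
        (⟨i, j, rfl, rfl, h⟩ | ⟨i, a, b, rfl, rfl, h⟩)⟩ <;>
      rcases u with i' | ⟨a', b'⟩ <;>
      simp only [spinePos, legHeight, Sum.elim_inl, Sum.elim_inr, Nat.dist, Sum.inl.injEq,
        Sum.inr.injEq, Prod.mk.injEq, Fin.ext_iff, reduceCtorEq, if_false] <;>
      (try split_ifs) <;> omega) u v
  rw [if_neg huv, if_pos rfl, zero_add] at h
  exact h.trans (dist_le_detourDist (caterpillar_connected hm) u v)

end Caterpillar

section Orderings

variable [Fintype V]

/-- Listing the vertices by increasing color bounds the span from below, provided that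
`D(u,v) ≤ L(u) + L(v)` for a level function `L` with at most one zero. -/
lemma sq_add_one_le_of_level (N : ℕ) (hN : 1 ≤ N) (hcard : Fintype.card V = N + 1)
    (h L : V → ℕ) (S : ℕ) (hS : ∀ u v, Nat.dist (h u) (h v) ≤ S)
    (hL : ∀ u v, u ≠ v → N ≤ L u + L v + Nat.dist (h u) (h v))
    (hzero : ∀ u v, L u = 0 → L v = 0 → u = v) :
    N ^ 2 + 1 ≤ S + 2 * ∑ u, L u := by
  classical
  obtain ⟨e, he⟩ : ∃ e : Fin (N + 1) ≃ V, Monotone (h ∘ e) :=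
    ⟨(Tuple.sort (h ∘ (Fintype.equivFinOfCardEq hcard).symm)).trans
      (Fintype.equivFinOfCardEq hcard).symm, Tuple.monotone_sort (h ∘ (Fintype.equivFinOfCardEq hcard).symm)⟩
  have hsum : ∑ u, L u = ∑ i : Fin (N + 1), L (e i) := (e.sum_comp L).symm
  let ℓ : ℕ → ℕ := fun t => if ht : t < N + 1 then L (e ⟨t, ht⟩) else 0
  let g : ℕ → ℕ := fun t => if ht : t < N + 1 then h (e ⟨t, ht⟩) else 0
  have hsum' : ∑ u, L u = ∑ t ∈ range (N + 1), ℓ t := by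
    rw [hsum, ← Fin.sum_univ_eq_sum_range]
    exact Finset.sum_congr rfl fun t _ => by simp [ℓ, t.is_le]
  have hstep : ∀ t < N, N + g t ≤ ℓ t + ℓ (t + 1) + g (t + 1) := by
    intro t ht
    have h₁ := hL (e ⟨t, by omega⟩) (e ⟨t + 1, by omega⟩) (by simp [Fin.ext_iff])
    have h₂ := he (show (⟨t, by omega⟩ : Fin (N + 1)) ≤ ⟨t + 1, by omega⟩ by simp)
    simp only [Function.comp, Nat.dist] at h₁ h₂
    simp only [g, ℓ, show t < N + 1 by omega, show t + 1 < N + 1 by omega, dif_pos]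
    omega
  have htel : ∀ t ≤ N, t * N + g 0 + ℓ 0 + ℓ t ≤ g t + 2 * ∑ i ∈ range (t + 1), ℓ i := by
    intro t
    induction t with
    | zero => simp; omega
    | succ t ih =>
      intro ht
      have h₁ := ih (by omega)
      have h₂ := hstep t (by omega)
      rw [sum_range_succ, Nat.succ_mul]
      omega
  have hN' := htel N le_rfl
  have hspan := hS (e ⟨0, by omega⟩) (e ⟨N, by omega⟩)
  have hpos : 1 ≤ ℓ 0 + ℓ N := by
    by_contra hlt
    have h₁ : L (e ⟨0, by omega⟩) = 0 := by
      have : ℓ 0 = 0 := by omega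
      simpa [ℓ] using this
    have h₂ : L (e ⟨N, by omega⟩) = 0 := by
      have : ℓ N = 0 := by omega
      simpa [ℓ] using this
    have := e.injective (hzero _ _ h₁ h₂)
    simp only [Fin.mk.injEq] at this
    omega
  have hg0 : g 0 = h (e ⟨0, by omega⟩) := by simp [g]
  have hgN : g N = h (e ⟨N, by omega⟩) := by simp [g]
  rw [hsum', sq]
  simp only [Nat.dist] at hspan
  omega

/-- The coloring which assigns the colors greedily along an enumeration `i` of the vertices. -/
lemma exists_coloring_of_enumeration (N k : ℕ) (hk : 1 ≤ k) (hN : 4 * k - 1 ≤ N)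
    (hcard : Fintype.card V = N + 1) (D : V → V → ℕ) (L i : V → ℕ)
    (hi : Function.Injective i) (hlt : ∀ u, i u < N + 1)
    (hD : ∀ u v, D u v = D v u) (hpos : ∀ u v, u ≠ v → 1 ≤ D u v) (hL : ∀ u, L u ≤ k)
    (hnext : ∀ u v, i v = i u + 1 → L u + L v ≤ D u v)
    (hnear : ∀ u v, u ≠ v → L u + L v ≤ D u v + 2 * (k - 1))
    (hfirst : ∀ u, i u = 0 → L u = 0) (hlast : ∀ u, i u = N → L u = 1) :
    ∃ h : V → ℕ, (∀ u v, u ≠ v → N ≤ D u v + Nat.dist (h u) (h v)) ∧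
      ∀ u, h u + 2 * ∑ v, L v ≤ N ^ 2 + 1 := by
  classical
  have hbij : Function.Bijective fun u => (⟨i u, hlt u⟩ : Fin (N + 1)) := by
    rw [Fintype.bijective_iff_injective_and_card]
    exact ⟨fun u v huv => hi (by simpa using huv), by simp [hcard]⟩
  let e := Equiv.ofBijective _ hbij
  have hie : ∀ t (ht : t < N + 1), i (e.symm ⟨t, ht⟩) = t := fun t ht =>
    congrArg Fin.val (e.apply_symm_apply ⟨t, ht⟩)
  let ℓ : ℕ → ℕ := fun t => if ht : t < N + 1 then L (e.symm ⟨t, ht⟩) else 0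
  have hℓ : ∀ u, ℓ (i u) = L u := by
    intro u
    have : e.symm ⟨i u, hlt u⟩ = u := e.symm_apply_apply u
    simp only [ℓ, hlt u, dif_pos, this]
  have hℓk : ∀ t, ℓ t ≤ k := by
    intro t
    simp only [ℓ]
    split_ifs
    · exact hL _
    · omega
  let c : ℕ → ℕ := fun t => ∑ s ∈ range t, (N - ℓ s - ℓ (s + 1))
  have hc : ∀ t, c (t + 1) + ℓ t + ℓ (t + 1) = c t + N := by
    intro t
    have h₁ := hℓk t
    have h₂ := hℓk (t + 1)
    simp only [c, sum_range_succ]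
    omega
  have hmono : Monotone c := monotone_nat_of_le_succ fun t => by
    have h₁ := hℓk t
    have h₂ := hℓk (t + 1)
    have := hc t
    omega
  have hsum : ∑ u, L u = ∑ t ∈ range (N + 1), ℓ t := by
    rw [← e.symm.sum_comp L, ← Fin.sum_univ_eq_sum_range]
    exact Finset.sum_congr rfl fun t _ => by simp [ℓ, t.is_le]
  have htel : ∀ t, c t + 2 * ∑ s ∈ range (t + 1), ℓ s = t * N + ℓ 0 + ℓ t := by
    intro t
    induction t with
    | zero => simp [c]; omega
    | succ t ih =>
      have h₁ := hc t
      have h₂ : (t + 1) * N = t * N + N := Nat.succ_mul t N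
      rw [sum_range_succ]
      omega
  refine ⟨fun u => c (i u), ?_, ?_⟩
  · have key : ∀ u v, i u < i v → N ≤ D u v + Nat.dist (c (i u)) (c (i v)) := by
      intro u v huv
      have hne : u ≠ v := fun h => by simp [h] at huv
      have h₀ := hc (i u)
      have h₁ := hc (i u + 1)
      have h₂ := hc (i u + 2)
      have hkb := hℓk (i u + 1)
      have hkc := hℓk (i u + 2)
      have hkd := hℓk (i u + 3)
      have hku := hL u
      have hnr := hnear u v hne
      have hp := hpos u v hne
      have hu := hℓ u
      have hv := hℓ v
      simp only [Nat.dist]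
      rcases lt_trichotomy (i v) (i u + 2) with h | h | h
      · have h' : i v = i u + 1 := by omega
        have := hnext u v h'
        rw [h'] at hv ⊢
        omega
      · rw [h] at hv ⊢
        rw [show i u + 1 + 1 = i u + 2 from rfl] at h₁
        omega
      · have := hmono (show i u + 3 ≤ i v by omega)
        rw [show i u + 1 + 1 = i u + 2 from rfl] at h₁
        rw [show i u + 2 + 1 = i u + 3 from rfl] at h₂
        omega
    intro u v huv
    rcases lt_or_gt_of_ne (hi.ne huv) with h | h
    · exact key u v h
    · rw [hD, Nat.dist_comm]
      exact key v u h
  · intro u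
    have h₁ := hmono (show i u ≤ N by have := hlt u; omega)
    have h₂ := htel N
    have h₃ : ℓ 0 = 0 := by
      simpa [ℓ] using hfirst _ (hie 0 (by omega))
    have h₄ : ℓ N = 1 := by
      simpa [ℓ] using hlast _ (hie N (by omega))
    rw [hsum, sq]
    dsimp only
    omega

end Orderings

section Span

lemma dist_le_spanOf [Finite V] (h : V → ℕ) (u v : V) : Nat.dist (h u) (h v) ≤ spanOf h :=
  le_csSup (Set.finite_range _).bddAbove ⟨(u, v), rfl⟩

lemma spanOf_le [Nonempty V] {h : V → ℕ} {S : ℕ} (hS : ∀ u, h u ≤ S) : spanOf h ≤ S := by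
  refine csSup_le (Set.range_nonempty _) ?_
  rintro _ ⟨⟨u, v⟩, rfl⟩
  have h₁ := hS u
  have h₂ := hS v
  simp only [Nat.dist]
  omega

end Span

section Values

lemma sum_dist_center (k : ℕ) : ∑ i ∈ range (2 * k + 1), Nat.dist i k = k * (k + 1) := by
  induction k with
  | zero => simp [Nat.dist]
  | succ k ih =>
    rw [show 2 * (k + 1) + 1 = 2 * k + 1 + 1 + 1 by ring, sum_range_succ', sum_range_succ]
    simp only [Nat.dist_succ_succ, ih]
    simp only [Nat.dist]
    rw [show 2 * k + 1 - k = k + 1 by omega, show k - (2 * k + 1) = 0 by omega]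
    simp only [zero_add, Nat.zero_sub, Nat.sub_zero, add_zero]
    ring

end Values

section OddCaterpillar

variable {k d : ℕ}

lemma card_caterpillar (hk : 1 ≤ k) (hd : 3 ≤ d) :
    Fintype.card (Fin (2 * k + 1) ⊕ Fin (2 * k + 1 - 2) × Fin (d - 2)) =
      (2 * k - 1) * (d - 1) + 2 := by
  obtain ⟨k, rfl⟩ := Nat.exists_eq_add_of_le' hk
  obtain ⟨d, rfl⟩ := Nat.exists_eq_add_of_le' hd
  simp only [Fintype.card_sum, Fintype.card_prod, Fintype.card_fin]
  rw [show 2 * (k + 1) + 1 - 2 = 2 * k + 1 by omega, show 2 * (k + 1) - 1 = 2 * k + 1 by omega,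
    show d + 3 - 2 = d + 1 by omega, show d + 3 - 1 = d + 2 by omega]
  ring

lemma sum_levelAt_center (hk : 1 ≤ k) :
    ∑ x : Fin (2 * k + 1) ⊕ Fin (2 * k + 1 - 2) × Fin (d - 2), levelAt k x =
      k * (k + 1) + (d - 2) * ((k - 1) * k + (2 * k - 1)) := by
  obtain ⟨k, rfl⟩ := Nat.exists_eq_add_of_le' hk
  simp only [Fintype.sum_sum_type, Fintype.sum_prod_type, levelAt, spinePos, legHeight,
    Sum.elim_inl, Sum.elim_inr, add_zero, Nat.dist_succ_succ, sum_const, card_univ,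
    Fintype.card_fin, smul_eq_mul, ← mul_sum]
  rw [Fin.sum_univ_eq_sum_range (fun i => Nat.dist i (k + 1)), sum_dist_center,
    Fin.sum_univ_eq_sum_range (fun i => Nat.dist i k + 1),
    show 2 * (k + 1) + 1 - 2 = 2 * k + 1 by omega, sum_add_distrib, sum_dist_center]
  simp only [sum_const, card_range, smul_eq_mul, mul_one, Nat.add_sub_cancel]
  rw [show 2 * (k + 1) - 1 = 2 * k + 1 by omega]

lemma levelAt_center_le (x : Fin (2 * k + 1) ⊕ Fin (2 * k + 1 - 2) × Fin (d - 2)) :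
    levelAt k x ≤ k := by
  rcases x with i | ⟨a, b⟩ <;>
  simp only [levelAt, spinePos, legHeight, Sum.elim_inl, Sum.elim_inr, Nat.dist] <;> omega

lemma eq_center_of_levelAt_eq_zero
    {x : Fin (2 * k + 1) ⊕ Fin (2 * k + 1 - 2) × Fin (d - 2)} (h : levelAt k x = 0) :
    x = Sum.inl ⟨k, by omega⟩ := by
  rcases x with i | ⟨a, b⟩ <;>
  simp only [levelAt, spinePos, legHeight, Sum.elim_inl, Sum.elim_inr, Nat.dist] at h
  · exact congrArg Sum.inl (Fin.ext (by dsimp only; omega))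
  · omega

/-- Two vertices of the same branch share at most `k - 1` edges on their paths to the center. -/
lemma levelAt_add_levelAt_le {u v : Fin (2 * k + 1) ⊕ Fin (2 * k + 1 - 2) × Fin (d - 2)}
    (huv : u ≠ v) :
    levelAt k u + levelAt k v ≤
      Nat.dist (spinePos u) (spinePos v) + legHeight u + legHeight v + 2 * (k - 1) := by
  rcases u with i | ⟨a, b⟩ <;> rcases v with j | ⟨a', b'⟩ <;>
  simp only [levelAt, spinePos, legHeight, Sum.elim_inl, Sum.elim_inr, Nat.dist, ne_eq,
    Sum.inl.injEq, Fin.ext_iff] at huv ⊢ <;> omega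

lemma one_le_dist_spinePos_add {u v : Fin (2 * k + 1) ⊕ Fin (2 * k + 1 - 2) × Fin (d - 2)}
    (huv : u ≠ v) :
    1 ≤ Nat.dist (spinePos u) (spinePos v) + legHeight u + legHeight v := by
  rcases u with i | ⟨a, b⟩ <;> rcases v with j | ⟨a', b'⟩ <;>
  simp only [spinePos, legHeight, Sum.elim_inl, Sum.elim_inr, Nat.dist, ne_eq,
    Sum.inl.injEq, Fin.ext_iff] at huv ⊢ <;> omega

lemma exists_injOn_lt_card {V : Type*} (A : Finset V) :
    ∃ f : V → ℕ, (∀ u ∈ A, ∀ v ∈ A, f u = f v → u = v) ∧ ∀ u ∈ A, f u < A.card := by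
  classical
  refine ⟨fun u => if h : u ∈ A then A.equivFin ⟨u, h⟩ else 0, ?_, ?_⟩
  · intro u hu v hv h
    simpa [hu, hv, Fin.val_inj] using h
  · intro u hu
    simp [hu]

/-- The reflection of the caterpillar exchanges the vertices left and right of the center. -/
lemma card_left_eq_card_right :
    ({u : Fin (2 * k + 1) ⊕ Fin (2 * k + 1 - 2) × Fin (d - 2) | spinePos u < k} : Finset _).card =
    ({u : Fin (2 * k + 1) ⊕ Fin (2 * k + 1 - 2) × Fin (d - 2) | k < spinePos u} : Finset _).card := by
  have hpos : ∀ u : Fin (2 * k + 1) ⊕ Fin (2 * k + 1 - 2) × Fin (d - 2),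
      spinePos (Sum.map Fin.rev (Prod.map Fin.rev id) u) + spinePos u = 2 * k := by
    rintro (i | ⟨a, b⟩) <;> simp [spinePos, Fin.val_rev] <;> omega
  have hinv : ∀ u : Fin (2 * k + 1) ⊕ Fin (2 * k + 1 - 2) × Fin (d - 2),
      Sum.map Fin.rev (Prod.map Fin.rev id) (Sum.map Fin.rev (Prod.map Fin.rev id) u) = u := by
    rintro (i | ⟨a, b⟩) <;> simp
  refine Finset.card_nbij' (Sum.map Fin.rev (Prod.map Fin.rev id))
    (Sum.map Fin.rev (Prod.map Fin.rev id)) ?_ ?_ (fun u _ => hinv u) (fun u _ => hinv u)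
  · intro u hu
    have h₁ := (mem_filter_univ _).1 (mem_coe.1 hu)
    have h₂ := hpos u
    exact mem_coe.2 ((mem_filter_univ _).2 (by omega))
  · intro u hu
    have h₁ := (mem_filter_univ _).1 (mem_coe.1 hu)
    have h₂ := hpos u
    exact mem_coe.2 ((mem_filter_univ _).2 (by omega))

/-- The vertices can be enumerated from the center to a neighbor of the center such that
consecutive vertices lie in different branches at the center. -/
lemma exists_enumeration (hk : 1 ≤ k) (hd : 3 ≤ d) {N : ℕ}
    (hN : Fintype.card (Fin (2 * k + 1) ⊕ Fin (2 * k + 1 - 2) × Fin (d - 2)) = N + 1) :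
    ∃ i : Fin (2 * k + 1) ⊕ Fin (2 * k + 1 - 2) × Fin (d - 2) → ℕ,
      Function.Injective i ∧ (∀ u, i u < N + 1) ∧
      (∀ u v, i v = i u + 1 → levelAt k u + levelAt k v ≤
        Nat.dist (spinePos u) (spinePos v) + legHeight u + legHeight v) ∧
      (∀ u, i u = 0 → levelAt k u = 0) ∧ (∀ u, i u = N → levelAt k u = 1) := by
  classical
  set A : Finset (Fin (2 * k + 1) ⊕ Fin (2 * k + 1 - 2) × Fin (d - 2)) :=
    {u | spinePos u < k} with hA
  set B : Finset (Fin (2 * k + 1) ⊕ Fin (2 * k + 1 - 2) × Fin (d - 2)) :=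
    {u | k < spinePos u} with hB
  set C : Finset (Fin (2 * k + 1) ⊕ Fin (2 * k + 1 - 2) × Fin (d - 2)) :=
    {u | spinePos u = k ∧ legHeight u = 1} with hC
  have memA : ∀ u, u ∈ A ↔ spinePos u < k := by simp [hA]
  have memB : ∀ u, u ∈ B ↔ k < spinePos u := by simp [hB]
  have memC : ∀ u, u ∈ C ↔ spinePos u = k ∧ legHeight u = 1 := by simp [hC]
  have hAB : A.card = B.card := card_left_eq_card_right
  have hleg : ∀ u : Fin (2 * k + 1) ⊕ Fin (2 * k + 1 - 2) × Fin (d - 2),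
      legHeight u = 0 ∨ legHeight u = 1 := by
    rintro (i | p)
    · exact Or.inl rfl
    · exact Or.inr rfl
  have hcenter : ∀ u : Fin (2 * k + 1) ⊕ Fin (2 * k + 1 - 2) × Fin (d - 2),
      spinePos u = k → legHeight u = 0 → u = Sum.inl ⟨k, by omega⟩ := fun u h₁ h₂ =>
    eq_center_of_levelAt_eq_zero (by simp [levelAt, h₁, h₂])
  have hcard : A.card + B.card + C.card + 1 = N + 1 := by
    have hABd : Disjoint A B := by
      rw [Finset.disjoint_left]
      intro u h₁ h₂
      rw [memA] at h₁
      rw [memB] at h₂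
      omega
    have hABC : Disjoint (A ∪ B) C := by
      rw [Finset.disjoint_left]
      intro u h₁ h₂
      rw [mem_union, memA, memB] at h₁
      rw [memC] at h₂
      omega
    have hc : (Sum.inl ⟨k, by omega⟩ :
        Fin (2 * k + 1) ⊕ Fin (2 * k + 1 - 2) × Fin (d - 2)) ∉ A ∪ B ∪ C := by
      simp [memA, memB, memC, spinePos, legHeight]
    have huniv : insert (Sum.inl ⟨k, by omega⟩) (A ∪ B ∪ C) = univ := by
      refine eq_univ_of_forall fun u => ?_
      rw [mem_insert, mem_union, mem_union, memA, memB, memC]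
      have h₁ := hcenter u
      have h₂ := hleg u
      by_cases h₃ : u = Sum.inl ⟨k, by omega⟩
      · exact Or.inl h₃
      · right
        have h₄ : ¬ (spinePos u = k ∧ legHeight u = 0) := fun h => h₃ (h₁ h.1 h.2)
        omega
    rw [← hN, ← card_univ, ← huniv, card_insert_of_notMem hc, card_union_of_disjoint hABC,
      card_union_of_disjoint hABd]
  have hCpos : 0 < C.card := by
    refine card_pos.2 ⟨Sum.inr (⟨k - 1, by omega⟩, ⟨0, by omega⟩), ?_⟩
    exact (memC _).2 ⟨Nat.sub_add_cancel hk, rfl⟩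
  obtain ⟨f, hf, hf'⟩ := exists_injOn_lt_card A
  obtain ⟨g, hg, hg'⟩ := exists_injOn_lt_card B
  obtain ⟨l, hl, hl'⟩ := exists_injOn_lt_card C
  obtain ⟨i, hi⟩ : ∃ i : Fin (2 * k + 1) ⊕ Fin (2 * k + 1 - 2) × Fin (d - 2) → ℕ, ∀ u,
      (u ∈ A ∧ spinePos u < k ∧ f u < A.card ∧ i u = 2 * f u + 1) ∨
      (u ∈ B ∧ k < spinePos u ∧ g u < A.card ∧ i u = 2 * g u + 2) ∨
      (u ∈ C ∧ spinePos u = k ∧ legHeight u = 1 ∧ l u < C.card ∧ i u = 2 * A.card + 1 + l u) ∨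
      (u = Sum.inl ⟨k, by omega⟩ ∧ spinePos u = k ∧ legHeight u = 0 ∧ i u = 0) := by
    refine ⟨fun u => if u ∈ A then 2 * f u + 1 else if u ∈ B then 2 * g u + 2 else
      if u ∈ C then 2 * A.card + 1 + l u else 0, fun u => ?_⟩
    by_cases h₁ : u ∈ A
    · exact Or.inl ⟨h₁, (memA u).1 h₁, hf' u h₁, if_pos h₁⟩
    by_cases h₂ : u ∈ B
    · exact Or.inr (Or.inl ⟨h₂, (memB u).1 h₂, hAB ▸ hg' u h₂, by simp [h₁, h₂]⟩)
    by_cases h₃ : u ∈ C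
    · exact Or.inr (Or.inr (Or.inl ⟨h₃, ((memC u).1 h₃).1, ((memC u).1 h₃).2, hl' u h₃,
        by simp [h₁, h₂, h₃]⟩))
    have h₄ : spinePos u = k := by
      rw [memA] at h₁
      rw [memB] at h₂
      omega
    have h₅ : legHeight u = 0 := (hleg u).resolve_right fun h => h₃ ((memC u).2 ⟨h₄, h⟩)
    exact Or.inr (Or.inr (Or.inr ⟨hcenter u h₄ h₅, h₄, h₅, by simp [h₁, h₂, h₃]⟩))
  refine ⟨i, fun u v huv => ?_, fun u => ?_, fun u v huv => ?_, fun u hu => ?_, fun u hu => ?_⟩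
  · rcases hi u with ⟨hu, -, h₁, h₂⟩ | ⟨hu, -, h₁, h₂⟩ | ⟨hu, -, -, h₁, h₂⟩ | ⟨hu, -, -, h₂⟩ <;>
    rcases hi v with ⟨hv, -, h₃, h₄⟩ | ⟨hv, -, h₃, h₄⟩ | ⟨hv, -, -, h₃, h₄⟩ | ⟨hv, -, -, h₄⟩ <;>
    first
    | exact hf u hu v hv (by omega)
    | exact hg u hu v hv (by omega)
    | exact hl u hu v hv (by omega)
    | exact hu.trans hv.symm
    | omega
  · have := hi u
    omega
  · have h₁ := hi u
    have h₂ := hi v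
    simp only [levelAt, Nat.dist]
    omega
  · have := hi u
    simp only [levelAt, Nat.dist]
    omega
  · have := hi u
    simp only [levelAt, Nat.dist]
    omega

lemma hc_odd_caterpillar (hk : 1 ≤ k) (hd : 3 ≤ d) :
    hc (caterpillar (2 * k + 1) d) +
        2 * (k * (k + 1) + (d - 2) * ((k - 1) * k + (2 * k - 1))) =
      ((2 * k - 1) * (d - 1) + 1) ^ 2 + 1 := by
  have hcard := card_caterpillar hk hd
  have hsum := sum_levelAt_center (d := d) hk
  set N := (2 * k - 1) * (d - 1) + 1 with hN
  have hcard' : Fintype.card (Fin (2 * k + 1) ⊕ Fin (2 * k + 1 - 2) × Fin (d - 2)) = N + 1 := hcard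
  have hNk : 4 * k - 1 ≤ N := by
    have := Nat.mul_le_mul_left (2 * k - 1) (show 2 ≤ d - 1 by omega)
    omega
  rw [← hsum]
  have : Nonempty (Fin (2 * k + 1) ⊕ Fin (2 * k + 1 - 2) × Fin (d - 2)) :=
    ⟨Sum.inl ⟨k, by omega⟩⟩
  obtain ⟨i, hi, hlt, hnext, hfirst, hlast⟩ := exists_enumeration hk hd hcard'
  obtain ⟨h, hcol, hle⟩ := exists_coloring_of_enumeration N k hk hNk hcard'
    (fun u v => Nat.dist (spinePos u) (spinePos v) + legHeight u + legHeight v) (levelAt k) i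
    hi hlt (fun u v => by simp only [Nat.dist_comm (spinePos u)]; ring)
    (fun _ _ => one_le_dist_spinePos_add) levelAt_center_le hnext
    (fun _ _ => levelAt_add_levelAt_le) hfirst hlast
  have hham : IsHamiltonianColoring (caterpillar (2 * k + 1) d) h := by
    intro u v huv
    have h₁ := hcol u v huv
    have h₂ := le_detourDist_caterpillar (by omega) huv
    omega
  apply le_antisymm
  · have h₁ : hc (caterpillar (2 * k + 1) d) ≤ spanOf h := Nat.sInf_le ⟨h, hham, rfl⟩
    have h₂ : spanOf h ≤ N ^ 2 + 1 - 2 * ∑ x :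
        Fin (2 * k + 1) ⊕ Fin (2 * k + 1 - 2) × Fin (d - 2), levelAt k x :=
      spanOf_le fun u => by
        have := hle u
        omega
    have h₃ := hle (Sum.inl ⟨k, by omega⟩)
    omega
  · obtain ⟨h', hham', hspan⟩ : hc (caterpillar (2 * k + 1) d) ∈
        {s | ∃ h, IsHamiltonianColoring (caterpillar (2 * k + 1) d) h ∧ spanOf h = s} :=
      Nat.sInf_mem ⟨_, h, hham, rfl⟩
    rw [← hspan]
    refine sq_add_one_le_of_level N (by omega) hcard' h' (levelAt k) _ (dist_le_spanOf h') ?_ ?_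
    · intro u v huv
      have h₁ := hham' u v huv
      have h₂ := detourDist_caterpillar_le ⟨k, by omega⟩ u v
      dsimp only at h₂
      omega
    · intro u v hu hv
      rw [eq_center_of_levelAt_eq_zero hu, eq_center_of_levelAt_eq_zero hv]

end OddCaterpillar

/-- For odd `m = 2k+1 ≥ 3` and `d ≥ 3`, the caterpillar `C(m,d)` of order
`n = (2k-1)(d-1) + 2` has `hc(C(m,d)) = ((2d-3)/(2d-2))(n-2)² + (d-1)/2`, i.e.
`2(d-1)·hc = (2d-3)(n-2)² + (d-1)²`, equivalently
`2·hc = (d-1)((2d-3)(2k-1)² + 1)`. -/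
theorem stmt18 (k d : ℕ) (hk : 1 ≤ k) (hd : 3 ≤ d) :
    Fintype.card (Fin (2 * k + 1) ⊕ Fin (2 * k + 1 - 2) × Fin (d - 2)) =
      (2 * k - 1) * (d - 1) + 2 ∧
    2 * (d - 1) * hc (caterpillar (2 * k + 1) d) =
      (2 * d - 3) * ((2 * k - 1) * (d - 1)) ^ 2 + (d - 1) ^ 2 ∧
    2 * hc (caterpillar (2 * k + 1) d) =
      (d - 1) * ((2 * d - 3) * (2 * k - 1) ^ 2 + 1) := by
  have h₁ : 2 * hc (caterpillar (2 * k + 1) d) =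
      (d - 1) * ((2 * d - 3) * (2 * k - 1) ^ 2 + 1) := by
    have h := hc_odd_caterpillar hk hd
    obtain ⟨k, rfl⟩ := Nat.exists_eq_add_of_le' hk
    obtain ⟨d, rfl⟩ := Nat.exists_eq_add_of_le' hd
    generalize hc (caterpillar (2 * (k + 1) + 1) (d + 3)) = s at h ⊢
    rw [show 2 * (k + 1) - 1 = 2 * k + 1 by omega, show d + 3 - 2 = d + 1 by omega,
      show d + 3 - 1 = d + 2 by omega, Nat.add_sub_cancel] at h
    rw [show 2 * (k + 1) - 1 = 2 * k + 1 by omega, show d + 3 - 1 = d + 2 by omega,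
      show 2 * (d + 3) - 3 = 2 * d + 3 by omega]
    linarith
  refine ⟨card_caterpillar hk hd, ?_, h₁⟩
  rw [mul_right_comm, h₁]
  ring

end HCPaper
end
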